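/- Let d and q satisfy d ≡ 3 (mod 4) and q ≡ 3 (mod 4), with d ≥ 3. If A ⊆ F_q^d is a square distance set, then (as an inequality of real numbers) |A| ≤ 2q^{(d+1)/2} / (q − 1 + (q+1)·q^{−(d−1)/2}). -/

import Mathlib

open Finset

/-- `‖x‖ = x₁² + ⋯ + x_d²` for `x ∈ F_q^d`. -/
def normSq {d : ℕ} {F : Type} [Field F] [Fintype F] (x : Fin d → F) : F := ∑ i, x i ^ 2

/-- `A` is a square distance set: every distance `‖x−y‖` (x, y ∈ A) is zero or a
nonzero square of `F_q`. -/
def IsSquareDistanceSet {d : ℕ} {F : Type} [Field F] [Fintype F]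
    (A : Finset (Fin d → F)) : Prop :=
  ∀ x ∈ A, ∀ y ∈ A, normSq (x - y) = 0 ∨ (IsSquare (normSq (x - y)) ∧ normSq (x - y) ≠ 0)

lemma AddChar.map_sum_eq_prod {ι M R : Type*} [AddCommMonoid M] [CommMonoid R] (ψ : AddChar M R)
    (s : Finset ι) (f : ι → M) : ψ (∑ i ∈ s, f i) = ∏ i ∈ s, ψ (f i) :=
  map_prod ψ.toMonoidHom (fun i => Multiplicative.ofAdd (f i)) s

lemma sum_sum_addChar_dotProduct_sub {F : Type} [Field F] [Finite F] {d : ℕ} (ψ : AddChar F ℂ)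
    (A : Finset (Fin d → F)) (ξ : Fin d → F) :
    ∑ x ∈ A, ∑ y ∈ A, ψ (ξ ⬝ᵥ (x - y)) = (Complex.normSq (∑ x ∈ A, ψ (ξ ⬝ᵥ x)) : ℂ) := by
  rw [← Complex.mul_conj, map_sum, Finset.sum_mul_sum]
  simp_rw [← AddChar.map_neg_eq_conj, ← AddChar.map_add_eq_mul, dotProduct_sub, sub_eq_add_neg]

section QuadraticGaussSums

variable {F : Type} [Field F] [Fintype F] [DecidableEq F]

/-- The quadratic character of a finite field, with complex values. -/
noncomputable def complexQuadraticChar (F : Type) [Field F] [Fintype F] [DecidableEq F] :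
    MulChar F ℂ :=
  (quadraticChar F).ringHomComp (Int.castRingHom ℂ)

local notation "η" => complexQuadraticChar F

lemma complexQuadraticChar_apply (a : F) : η a = ((quadraticChar F a : ℤ) : ℂ) := rfl

@[simp]
lemma complexQuadraticChar_zero : η 0 = 0 := MulChar.map_zero _

lemma complexQuadraticChar_isQuadratic : (η).IsQuadratic :=
  (quadraticChar_isQuadratic F).comp _

lemma complexQuadraticChar_ne_one (hF : ringChar F ≠ 2) : η ≠ 1 := by
  obtain ⟨a, ha⟩ := quadraticChar_exists_neg_one' hF
  intro h
  have h' := complexQuadraticChar_apply (a : F)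
  rw [h, MulChar.one_apply a.isUnit, ha] at h'
  norm_num at h'

lemma complexQuadraticChar_mul_self {a : F} (ha : a ≠ 0) : η a * η a = 1 := by
  rw [complexQuadraticChar_apply, ← Int.cast_mul, ← pow_two, quadraticChar_sq_one ha, Int.cast_one]

lemma complexQuadraticChar_neg_one (hF : ringChar F ≠ 2) (hq : Fintype.card F % 4 = 3) :
    η (-1) = -1 := by
  rw [complexQuadraticChar_apply, quadraticChar_neg_one hF, ZMod.χ₄_nat_three_mod_four hq]
  norm_num

lemma gaussSum_complexQuadraticChar_mulShift (hF : ringChar F ≠ 2) (ψ : AddChar F ℂ) (a : F) :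
    ∑ r, η r * ψ (r * a) = η a * gaussSum η ψ := by
  by_cases ha : a = 0
  · have h := MulChar.sum_eq_zero_of_ne_one (complexQuadraticChar_ne_one hF)
    simpa [ha] using h
  · have h := gaussSum_mulShift_eq η ψ (Units.mk0 a ha)
    rw [complexQuadraticChar_isQuadratic.inv] at h
    simpa [gaussSum, AddChar.mulShift_apply, mul_comm] using h

lemma sum_addChar_mul_sq (hF : ringChar F ≠ 2) {ψ : AddChar F ℂ} (hψ : ψ.IsPrimitive)
    {r : F} (hr : r ≠ 0) : ∑ t, ψ (r * t ^ 2) = η r * gaussSum η ψ := by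
  have h1 : ∑ t, ψ (r * t ^ 2) = ∑ a, (η a + 1) * ψ (a * r) := by
    rw [← Finset.sum_fiberwise (s := univ) (g := fun t : F => t ^ 2)]
    refine Finset.sum_congr rfl fun a _ => ?_
    have hcard := quadraticChar_card_sqrts hF a
    rw [Finset.sum_congr rfl (g := fun _ => ψ (a * r)), Finset.sum_const, nsmul_eq_mul,
      complexQuadraticChar_apply]
    · congr 1
      have hset : ({x : F | x ^ 2 = a} : Set F).toFinset = univ.filter (fun x => x ^ 2 = a) := by
        ext; simp
      rw [hset] at hcard
      exact_mod_cast hcard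
    · intro t ht
      rw [(Finset.mem_filter.mp ht).2.symm, mul_comm]
  simp only [h1, add_mul, one_mul, Finset.sum_add_distrib,
    gaussSum_complexQuadraticChar_mulShift hF, AddChar.sum_mulShift r hψ, if_neg hr]
  simp

lemma sum_addChar_quadratic (hF : ringChar F ≠ 2) {ψ : AddChar F ℂ} (hψ : ψ.IsPrimitive)
    {r : F} (hr : r ≠ 0) (z : F) :
    ∑ t, ψ (r * t ^ 2 + t * z) = η r * gaussSum η ψ * ψ (-(4 * r)⁻¹ * z ^ 2) := by
  have h2 : (2 : F) ≠ 0 := Ring.two_ne_zero hF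
  have h4 : (4 : F) ≠ 0 := by
    have : (4 : F) = 2 * 2 := by norm_num
    rw [this]; exact mul_ne_zero h2 h2
  rw [← sum_addChar_mul_sq hF hψ hr, Finset.sum_mul]
  refine Fintype.sum_equiv (Equiv.addRight (z / (2 * r))) _ _ fun t => ?_
  rw [← AddChar.map_add_eq_mul]
  congr 1
  simp only [Equiv.coe_addRight]
  field_simp
  ring

lemma sum_addChar_normSq_add_dotProduct {d : ℕ} (hF : ringChar F ≠ 2) {ψ : AddChar F ℂ}
    (hψ : ψ.IsPrimitive) {r : F} (hr : r ≠ 0) (z : Fin d → F) :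
    ∑ ξ : Fin d → F, ψ (r * normSq ξ + ξ ⬝ᵥ z) =
      (η r * gaussSum η ψ) ^ d * ψ (-(4 * r)⁻¹ * normSq z) := by
  have h1 : ∀ ξ : Fin d → F, ψ (r * normSq ξ + ξ ⬝ᵥ z) = ∏ i, ψ (r * ξ i ^ 2 + ξ i * z i) := by
    intro ξ
    rw [← AddChar.map_sum_eq_prod, Finset.sum_add_distrib, ← Finset.mul_sum]
    rfl
  simp_rw [h1]
  rw [← Fintype.prod_sum (fun i t => ψ (r * t ^ 2 + t * z i))]
  simp_rw [sum_addChar_quadratic hF hψ hr]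
  rw [Finset.prod_mul_distrib, ← AddChar.map_sum_eq_prod, ← Finset.mul_sum]
  simp [normSq]

lemma sum_addChar_dotProduct {d : ℕ} {ψ : AddChar F ℂ} (hψ : ψ.IsPrimitive) (z : Fin d → F) :
    ∑ ξ : Fin d → F, ψ (ξ ⬝ᵥ z) = if z = 0 then (Fintype.card F : ℂ) ^ d else 0 := by
  simp_rw [dotProduct, AddChar.map_sum_eq_prod]
  rw [← Fintype.prod_sum (fun i t => ψ (t * z i))]
  simp_rw [AddChar.sum_mulShift _ hψ]
  split_ifs with h
  · simp [h]
  · obtain ⟨i, hi⟩ := Function.ne_iff.mp h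
    exact Finset.prod_eq_zero (Finset.mem_univ i) (by simpa using hi)

lemma sum_erase_zero_gaussSum_add (hF : ringChar F ≠ 2) {ψ : AddChar F ℂ} (hψ : ψ.IsPrimitive)
    (b c : ℂ) (a : F) :
    ∑ r ∈ univ.erase (0 : F), (b * η r + c) * ψ (r * a) =
      b * (η a * gaussSum η ψ) + c * ((if a = 0 then (Fintype.card F : ℂ) else 0) - 1) := by
  rw [← gaussSum_complexQuadraticChar_mulShift hF, ← Nat.cast_zero (R := ℂ), ← Nat.cast_ite,
    ← AddChar.sum_mulShift a hψ, ← Finset.sum_erase_add _ _ (mem_univ (0 : F)),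
    ← Finset.sum_erase_add univ (fun r => ψ (r * a)) (mem_univ (0 : F))]
  simp only [add_mul, Finset.sum_add_distrib, mul_assoc, ← Finset.mul_sum]
  simp

/-- The Fourier transform of the multiplier `1 - η(‖ξ‖) - q·[‖ξ‖ = 0]`. -/
lemma sum_multiplier_mul_addChar {m : ℕ} (hm : Odd m) (hF : ringChar F ≠ 2)
    (hq : Fintype.card F % 4 = 3) {ψ : AddChar F ℂ} (hψ : ψ.IsPrimitive)
    (z : Fin (2 * m + 1) → F) :
    ∑ ξ : Fin (2 * m + 1) → F,
        (1 - η (normSq ξ) - if normSq ξ = 0 then (Fintype.card F : ℂ) else 0) * ψ (ξ ⬝ᵥ z) =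
      (Fintype.card F : ℂ) ^ m * (Fintype.card F * η (normSq z) +
        ((if normSq z = 0 then (Fintype.card F : ℂ) else 0) - 1)) := by
  set q : ℂ := (Fintype.card F : ℂ) with hqdef
  set G := gaussSum η ψ with hG
  have hq0 : q ≠ 0 := by simp [hqdef]
  have hneg : η (-1) = -1 := complexQuadraticChar_neg_one hF hq
  have hG2 : G ^ 2 = -q := by
    rw [hG, gaussSum_sq (complexQuadraticChar_ne_one hF) complexQuadraticChar_isQuadratic hψ, hneg]
    simp [hqdef]
  have h4η : η 4 = 1 := by
    have h : (4 : F) = 2 * 2 := by norm_num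
    rw [h, map_mul, complexQuadraticChar_mul_self (Ring.two_ne_zero hF)]
  have h4 : (4 : F) ≠ 0 := by
    intro h
    rw [h, MulChar.map_zero] at h4η
    exact zero_ne_one h4η
  have hGd : G ^ (2 * m + 1) = -q ^ m * G := by
    rw [pow_succ, pow_mul, hG2, hm.neg_pow]
  have hηd : ∀ r : F, r ≠ 0 → η r ^ (2 * m + 1) = η r := by
    intro r hr
    rw [pow_succ, pow_mul, pow_two, complexQuadraticChar_mul_self hr, one_pow, one_mul]
  have hinv : ∀ r : F, r ≠ 0 → η (-(4 * r)⁻¹) = -η r := by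
    intro r hr
    have h : η (-(4 * r)⁻¹) * (η (-1) * η 4 * η r) = 1 := by
      rw [← map_mul, ← map_mul, ← map_mul]
      have : -(4 * r)⁻¹ * (-1 * 4 * r) = 1 := by field_simp
      rw [this, map_one]
    rw [hneg, h4η] at h
    have h' := complexQuadraticChar_mul_self hr
    linear_combination (-η r) * h - η (-(4 * r)⁻¹) * h'
  apply mul_left_cancel₀ hq0
  calc
    _ = ∑ ξ : Fin (2 * m + 1) → F, ∑ r ∈ univ.erase (0 : F),
          (G * η r + -q) * ψ (r * normSq ξ + ξ ⬝ᵥ z) := by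
      rw [Finset.mul_sum]
      refine Finset.sum_congr rfl fun ξ _ => ?_
      simp_rw [AddChar.map_add_eq_mul, ← mul_assoc]
      rw [← Finset.sum_mul, sum_erase_zero_gaussSum_add hF hψ]
      linear_combination (-η (normSq ξ) * ψ (ξ ⬝ᵥ z)) * hG2
    _ = ∑ r ∈ univ.erase (0 : F), (G * η r + -q) *
          ((η r * G) ^ (2 * m + 1) * ψ (-(4 * r)⁻¹ * normSq z)) := by
      rw [Finset.sum_comm]
      refine Finset.sum_congr rfl fun r hr => ?_
      rw [← Finset.mul_sum, sum_addChar_normSq_add_dotProduct hF hψ (ne_of_mem_erase hr)]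
    _ = ∑ r ∈ univ.erase (0 : F), (-q ^ (m + 1) * G * η r + q ^ (m + 1)) *
          ψ (r * normSq z) := by
      have hmem : ∀ r ∈ univ.erase (0 : F), -(4 * r)⁻¹ ∈ univ.erase (0 : F) := by
        intro r hr
        simpa [h4] using hr
      have hinvol : ∀ r ∈ univ.erase (0 : F), -(4 * (-(4 * r)⁻¹))⁻¹ = r := by
        intro r hr
        have hr := ne_of_mem_erase hr
        field_simp
      refine Finset.sum_nbij' (fun r => -(4 * r)⁻¹) (fun r => -(4 * r)⁻¹)
        hmem hmem hinvol hinvol fun r hr => ?_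
      have hr := ne_of_mem_erase hr
      rw [mul_pow, hηd r hr, hGd, hinv r hr]
      have h' := complexQuadraticChar_mul_self hr
      linear_combination (-q ^ m * G ^ 2 * ψ (-(4 * r)⁻¹ * normSq z)) * h' -
        (q ^ m * ψ (-(4 * r)⁻¹ * normSq z)) * hG2
    _ = _ := by
      rw [sum_erase_zero_gaussSum_add hF hψ]
      linear_combination (-q ^ (m + 1) * η (normSq z)) * hG2

lemma sum_normSq_sum_addChar {d : ℕ} {ψ : AddChar F ℂ} (hψ : ψ.IsPrimitive)
    (A : Finset (Fin d → F)) :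
    ∑ ξ : Fin d → F, Complex.normSq (∑ x ∈ A, ψ (ξ ⬝ᵥ x)) =
      (Fintype.card F : ℝ) ^ d * A.card := by
  have h : ∑ ξ : Fin d → F, (Complex.normSq (∑ x ∈ A, ψ (ξ ⬝ᵥ x)) : ℂ) =
      (Fintype.card F : ℂ) ^ d * A.card := by
    simp_rw [← sum_sum_addChar_dotProduct_sub]
    rw [Finset.sum_comm]
    have : ∀ x ∈ A, ∑ ξ : Fin d → F, ∑ y ∈ A, ψ (ξ ⬝ᵥ (x - y)) = (Fintype.card F : ℂ) ^ d := by
      intro x hx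
      rw [Finset.sum_comm]
      simp_rw [sum_addChar_dotProduct hψ, sub_eq_zero]
      simp [hx]
    rw [Finset.sum_congr rfl this, Finset.sum_const, nsmul_eq_mul, mul_comm]
  exact_mod_cast h

lemma IsSquareDistanceSet.sum_multiplier_mul_normSq {m : ℕ} (hm : Odd m) (hF : ringChar F ≠ 2)
    (hq : Fintype.card F % 4 = 3) {ψ : AddChar F ℂ} (hψ : ψ.IsPrimitive)
    {A : Finset (Fin (2 * m + 1) → F)} (hA : IsSquareDistanceSet A) :
    ∑ ξ : Fin (2 * m + 1) → F, (1 - (quadraticChar F (normSq ξ) : ℝ) -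
        if normSq ξ = 0 then (Fintype.card F : ℝ) else 0) *
          Complex.normSq (∑ x ∈ A, ψ (ξ ⬝ᵥ x)) =
      (Fintype.card F : ℝ) ^ m * (Fintype.card F - 1) * (A.card : ℝ) ^ 2 := by
  have h : ∑ ξ : Fin (2 * m + 1) → F,
      (1 - η (normSq ξ) - if normSq ξ = 0 then (Fintype.card F : ℂ) else 0) *
          (Complex.normSq (∑ x ∈ A, ψ (ξ ⬝ᵥ x)) : ℂ) =
      (Fintype.card F : ℂ) ^ m * (Fintype.card F - 1) * (A.card : ℂ) ^ 2 := by
    have hxy : ∀ x ∈ A, ∀ y ∈ A, ∑ ξ : Fin (2 * m + 1) → F,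
        (1 - η (normSq ξ) - if normSq ξ = 0 then (Fintype.card F : ℂ) else 0) *
          ψ (ξ ⬝ᵥ (x - y)) = (Fintype.card F : ℂ) ^ m * (Fintype.card F - 1) := by
      intro x hx y hy
      rw [sum_multiplier_mul_addChar hm hF hq hψ]
      rcases hA x hx y hy with h0 | ⟨hs, h0⟩
      · simp [h0]
      · rw [complexQuadraticChar_apply, (quadraticChar_one_iff_isSquare h0).mpr hs, if_neg h0]
        push_cast
        ring
    simp_rw [← sum_sum_addChar_dotProduct_sub, Finset.mul_sum]
    rw [Finset.sum_comm, Finset.sum_congr rfl fun x hx =>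
      Finset.sum_comm.trans (Finset.sum_congr rfl fun y hy => hxy x hx y hy)]
    simp only [Finset.sum_const, nsmul_eq_mul]
    ring
  simp only [complexQuadraticChar_apply] at h
  apply Complex.ofReal_injective
  simpa [apply_ite Complex.ofReal] using h

lemma IsSquareDistanceSet.card_mul_le {m : ℕ} (hm : Odd m)
    (hq : Fintype.card F % 4 = 3) {A : Finset (Fin (2 * m + 1) → F)}
    (hA : IsSquareDistanceSet A) :
    (A.card : ℝ) * ((Fintype.card F : ℝ) ^ m * (Fintype.card F - 1) + (Fintype.card F + 1)) ≤
      2 * (Fintype.card F : ℝ) ^ (2 * m + 1) := by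
  have hF : ringChar F ≠ 2 := by
    intro h
    have := FiniteField.even_card_of_char_two h
    lia
  set ψ := AddChar.FiniteField.primitiveChar_to_Complex F
  have hψ : ψ.IsPrimitive := AddChar.FiniteField.primitiveChar_to_Complex_isPrimitive F
  have hsum := hA.sum_multiplier_mul_normSq hm hF hq hψ
  have hpars := sum_normSq_sum_addChar hψ A
  have hzero : Complex.normSq (∑ x ∈ A, ψ ((0 : Fin (2 * m + 1) → F) ⬝ᵥ x)) =
      (A.card : ℝ) ^ 2 := by
    simp [pow_two]
  have hn0 : normSq (0 : Fin (2 * m + 1) → F) = 0 := by simp [normSq]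
  rw [← Finset.sum_erase_add _ _ (mem_univ 0), hzero, hn0] at hsum
  rw [← Finset.sum_erase_add _ _ (mem_univ 0), hzero] at hpars
  have hle : ∑ ξ ∈ univ.erase (0 : Fin (2 * m + 1) → F),
      (1 - (quadraticChar F (normSq ξ) : ℝ) -
        if normSq ξ = 0 then (Fintype.card F : ℝ) else 0) *
          Complex.normSq (∑ x ∈ A, ψ (ξ ⬝ᵥ x)) ≤
      ∑ ξ ∈ univ.erase (0 : Fin (2 * m + 1) → F),
        2 * Complex.normSq (∑ x ∈ A, ψ (ξ ⬝ᵥ x)) := by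
    refine Finset.sum_le_sum fun ξ _ => mul_le_mul_of_nonneg_right ?_ (Complex.normSq_nonneg _)
    have h1 : (-1 : ℝ) ≤ quadraticChar F (normSq ξ) := by
      rcases quadraticChar_isQuadratic F (normSq ξ) with h | h | h <;> rw [h] <;> norm_num
    have h2 : (0 : ℝ) ≤ if normSq ξ = 0 then (Fintype.card F : ℝ) else 0 := by positivity
    linarith
  rw [← Finset.mul_sum] at hle
  simp only [MulChar.map_zero, Int.cast_zero, if_true] at hsum
  rcases A.card.eq_zero_or_pos with h0 | hpos
  · rw [h0]
    simp only [Nat.cast_zero, zero_mul]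
    positivity
  · have hpos' : (0 : ℝ) < A.card := by exact_mod_cast hpos
    refine le_of_mul_le_mul_left ?_ hpos'
    nlinarith

end QuadraticGaussSums

theorem squareDistanceSet_card_d3q3 (q d : ℕ) (F : Type) [Field F] [Fintype F] [DecidableEq F]
    (hcard : Fintype.card F = q) (hodd : Odd q)
    (hd : d % 4 = 3) (hq : q % 4 = 3) (hd3 : 3 ≤ d)
    (A : Finset (Fin d → F)) (hA : IsSquareDistanceSet A) :
    (A.card : ℝ) ≤ 2 * (q : ℝ) ^ ((d + 1) / 2) / ((q : ℝ) - 1 + ((q : ℝ) + 1) / (q : ℝ) ^ ((d - 1) / 2)) := by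
  subst hcard
  obtain ⟨m, hm, rfl⟩ : ∃ m, Odd m ∧ d = 2 * m + 1 :=
    ⟨d / 2, Nat.odd_iff.mpr (by lia), by lia⟩
  have h := hA.card_mul_le hm hq
  have hq1 : (1 : ℝ) < Fintype.card F := by exact_mod_cast Fintype.one_lt_card
  have hqm : (0 : ℝ) < (Fintype.card F : ℝ) ^ m := by positivity
  rw [show (2 * m + 1 + 1) / 2 = m + 1 by lia, show (2 * m + 1 - 1) / 2 = m by lia,
    le_div_iff₀ (add_pos_of_pos_of_nonneg (by linarith) (by positivity))]
  refine le_of_mul_le_mul_right ?_ hqm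
  calc
    _ = (A.card : ℝ) *
        ((Fintype.card F : ℝ) ^ m * (Fintype.card F - 1) + (Fintype.card F + 1)) := by
      field_simp
    _ ≤ _ := h
    _ = _ := by ring
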